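/- arXiv:2404.16751 — 2 statements merged into one kernel-verified Lean document; each statement's English description precedes it below -/
import Mathlib

section
/- Let f be a real polynomial of degree d. Then sup_{x in [0,1]} |f'(x)| ≤ 2 d^2 · sup_{x in [0,1]} |f(x)|. -/
open Polynomial in
/-- The Lagrange basis polynomials on strictly decreasing nodes alternate in sign to the right of
all the nodes. -/
lemma neg_one_pow_mul_eval_basis_nonneg {n : ℕ} {v : ℕ → ℝ}
    (hv : StrictAntiOn v (Finset.range n)) {x : ℝ} (hx : ∀ i < n, v i ≤ x) {i : ℕ} (hi : i < n) :
    0 ≤ (-1) ^ i * (Lagrange.basis (Finset.range n) v i).eval x := by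
  have union : (Finset.range n).erase i = Finset.range i ∪ Finset.Ioo i n := by grind
  have disjoint : Disjoint (Finset.range i) (Finset.Ioo i n) := by
    grind [Finset.disjoint_iff_ne]
  have left : 0 ≤ ∏ j ∈ Finset.range i, ((-1) * ((v i - v j)⁻¹ * (x - v j))) := by
    refine Finset.prod_nonneg fun j hj => ?_
    have hj := Finset.mem_range.mp hj
    have hlt : v i < v j := hv (by simp; omega) (by simpa using hi) hj
    have h₁ : (v i - v j)⁻¹ ≤ 0 := inv_nonpos.mpr (by linarith)
    have h₂ : 0 ≤ x - v j := sub_nonneg.mpr (hx j (by omega))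
    nlinarith
  have right : 0 ≤ ∏ j ∈ Finset.Ioo i n, ((v i - v j)⁻¹ * (x - v j)) := by
    refine Finset.prod_nonneg fun j hj => ?_
    have hj := Finset.mem_Ioo.mp hj
    have hlt : v j < v i := hv (by simpa using hi) (by simpa using hj.2) hj.1
    exact mul_nonneg (inv_nonneg.mpr (by linarith)) (sub_nonneg.mpr (hx j hj.2))
  rw [Finset.prod_mul_distrib, Finset.prod_const, Finset.card_range] at left
  simp only [Lagrange.basis, eval_prod, Lagrange.basisDivisor, eval_mul, eval_C, eval_sub, eval_X]
  rw [union, Finset.prod_union disjoint, ← mul_assoc]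
  exact mul_nonneg left right

open Polynomial in
/-- A polynomial dominated at the nodes by a polynomial of alternating signs is dominated by it to
the right of all the nodes. -/
lemma abs_eval_le_eval_of_abs_le_alternating {n : ℕ} {v : ℕ → ℝ}
    (hv : StrictAntiOn v (Finset.range n)) {P Q : ℝ[X]} (hP : P.degree < n) (hQ : Q.degree < n)
    (hPQ : ∀ i < n, |P.eval (v i)| ≤ (-1) ^ i * Q.eval (v i))
    {x : ℝ} (hx : ∀ i < n, v i ≤ x) : |P.eval x| ≤ Q.eval x := by
  have expand {R : ℝ[X]} (hR : R.degree < n) : R.eval x = ∑ i ∈ Finset.range n,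
      R.eval (v i) * (Lagrange.basis (Finset.range n) v i).eval x := by
    conv_lhs => rw [Lagrange.eq_interpolate (f := R) (s := Finset.range n) hv.injOn (by simpa using hR)]
    simp [Lagrange.interpolate_apply, eval_finsetSum]
  rw [expand hP, expand hQ]
  refine (Finset.abs_sum_le_sum_abs _ _).trans (Finset.sum_le_sum fun i hi => ?_)
  have hi := Finset.mem_range.mp hi
  have hb := neg_one_pow_mul_eval_basis_nonneg hv hx hi
  have hsq : ((-1 : ℝ) ^ i) * (-1) ^ i = 1 := by simp [← mul_pow]
  have habs : |(Lagrange.basis (Finset.range n) v i).eval x|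
      = (-1) ^ i * (Lagrange.basis (Finset.range n) v i).eval x := by
    rw [← abs_of_nonneg hb, abs_mul, abs_neg_one_pow, one_mul]
  rw [abs_mul, habs]
  refine (mul_le_mul_of_nonneg_right (hPQ i hi) hb).trans_eq ?_
  linear_combination (Q.eval (v i) * (Lagrange.basis (Finset.range n) v i).eval x) * hsq

open Polynomial Polynomial.Chebyshev in
/-- The Chebyshev polynomial of the second kind is bounded on `[-1, 1]` by its value at `1`. -/
lemma abs_eval_U_real_le {n : ℕ} (hn : n ≠ 0) {x : ℝ} (hx : |x| ≤ 1) :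
    |(U ℝ ((n : ℤ) - 1)).eval x| ≤ n := by
  have h := abs_iterate_derivative_T_real_le n 1 hx
  have hn' : (0 : ℝ) < n := by positivity
  simp only [Function.iterate_one, T_derivative_eq_U, eval_mul, Int.cast_natCast,
    eval_natCast, U_eval_one, abs_mul, Nat.abs_cast] at h
  have := le_of_mul_le_mul_left h hn'
  simpa using this

open Polynomial Polynomial.Chebyshev in
/-- The endpoint case of Schur's inequality. -/
lemma abs_eval_le_of_abs_eval_cos_mul_sin_le_of_cos_le {n : ℕ} (hn : n ≠ 0) {Q : ℝ[X]}
    (hQ : Q.degree < n) (hbnd : ∀ θ : ℝ, |Q.eval (Real.cos θ) * Real.sin θ| ≤ 1)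
    {x : ℝ} (hx : Real.cos (Real.pi / (2 * n)) ≤ x) (hx1 : x ≤ 1) : |Q.eval x| ≤ n := by
  have hn' : (0 : ℝ) < n := by positivity
  have hmem {i : ℕ} (hi : i < n) : 0 < (2 * (i : ℝ) + 1) * Real.pi / (2 * n) ∧
      (2 * (i : ℝ) + 1) * Real.pi / (2 * n) < Real.pi := by
    have : (i : ℝ) + 1 ≤ n := mod_cast hi
    refine ⟨by positivity, ?_⟩
    rw [div_lt_iff₀ (by positivity)]
    nlinarith [Real.pi_pos]
  have hanti : StrictAntiOn (fun k : ℕ => Real.cos ((2 * k + 1) * Real.pi / (2 * n)))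
      (Finset.range n) := by
    intro i hi j hj hij
    have hi := hmem (i := i) (by simpa using hi)
    have hj := hmem (i := j) (by simpa using hj)
    refine Real.strictAntiOn_cos ⟨hi.1.le, hi.2.le⟩ ⟨hj.1.le, hj.2.le⟩ ?_
    gcongr
  have hU : (U ℝ ((n : ℤ) - 1)).degree < n := by
    obtain ⟨m, rfl⟩ := Nat.exists_eq_succ_of_ne_zero hn
    simp only [Nat.succ_eq_add_one, Nat.cast_add, Nat.cast_one, add_sub_cancel_right,
      degree_U_natCast]
    exact_mod_cast Nat.lt_succ_self m
  have hle : ∀ i < n, Real.cos ((2 * i + 1) * Real.pi / (2 * n)) ≤ x := by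
    refine fun i hi => (Real.cos_le_cos_of_nonneg_of_le_pi (by positivity) (hmem hi).2.le ?_).trans
      hx
    gcongr
    nlinarith [Real.pi_pos, (Nat.cast_nonneg i : (0 : ℝ) ≤ i)]
  have hx0 : -1 ≤ x := (Real.neg_one_le_cos _).trans hx
  refine (abs_eval_le_eval_of_abs_le_alternating hanti hQ hU (fun i hi => ?_) hle).trans
    ((le_abs_self _).trans (abs_eval_U_real_le hn (abs_le.mpr ⟨hx0, hx1⟩)))
  set θ := (2 * (i : ℝ) + 1) * Real.pi / (2 * n) with hθ
  have hsin : 0 < Real.sin θ := Real.sin_pos_of_pos_of_lt_pi (hmem hi).1 (hmem hi).2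
  have hUθ : (U ℝ ((n : ℤ) - 1)).eval (Real.cos θ) * Real.sin θ = (-1) ^ i := by
    rw [U_real_cos]
    have : (((n : ℤ) - 1 : ℤ) + 1 : ℝ) * θ = Real.pi / 2 + i * Real.pi := by
      rw [hθ]; push_cast; field
    rw [this, Real.sin_add_nat_mul_pi, Real.sin_pi_div_two, mul_one]
  have hsq : ((-1 : ℝ) ^ i) * (-1) ^ i = 1 := by simp [← mul_pow]
  refine le_of_mul_le_mul_right ?_ hsin
  calc |Q.eval (Real.cos θ)| * Real.sin θ = |Q.eval (Real.cos θ) * Real.sin θ| := by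
        rw [abs_mul, abs_of_pos hsin]
    _ ≤ 1 := hbnd θ
    _ = (-1) ^ i * (U ℝ ((n : ℤ) - 1)).eval (Real.cos θ) * Real.sin θ := by
        rw [mul_assoc, hUθ, hsq]

open Polynomial in
/-- **Schur's inequality**: if `|Q(x)| √(1 - x²) ≤ 1` on `[-1, 1]` and `deg Q < n`, then
`|Q(x)| ≤ n` on `[-1, 1]`. -/
lemma abs_eval_le_of_abs_eval_cos_mul_sin_le {n : ℕ} (hn : n ≠ 0) {Q : ℝ[X]}
    (hQ : Q.degree < n) (hbnd : ∀ θ : ℝ, |Q.eval (Real.cos θ) * Real.sin θ| ≤ 1)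
    {x : ℝ} (hx : x ∈ Set.Icc (-1) 1) : |Q.eval x| ≤ n := by
  wlog hx0 : 0 ≤ x generalizing Q x
  · have := this (Q := Q.comp (-X)) (x := -x) ?_ (fun θ => ?_) (by grind) (by linarith)
    · simpa using this
    · rcases eq_or_ne Q 0 with rfl | h0
      · simp
      · refine degree_le_natDegree.trans_lt (Nat.cast_lt.mpr ?_)
        rw [natDegree_comp]
        simpa using (natDegree_lt_iff_degree_lt h0).mpr hQ
    · simpa [Real.cos_add_pi, Real.sin_add_pi] using hbnd (θ + Real.pi)
  rcases le_or_gt (Real.cos (Real.pi / (2 * n))) x with h | h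
  · exact abs_eval_le_of_abs_eval_cos_mul_sin_le_of_cos_le hn hQ hbnd h hx.2
  have hn' : (1 : ℝ) ≤ n := mod_cast Nat.one_le_iff_ne_zero.mpr hn
  have hcos : Real.cos (Real.arccos x) = x := Real.cos_arccos hx.1 hx.2
  have hle : Real.pi / (2 * n) ≤ Real.arccos x := by
    by_contra! hlt
    have : Real.pi / (2 * n) ≤ Real.pi := div_le_self Real.pi_pos.le (by linarith)
    have := Real.cos_le_cos_of_nonneg_of_le_pi (Real.arccos_nonneg x) this hlt.le
    linarith
  have harc : Real.arccos x ≤ Real.pi / 2 := Real.arccos_le_pi_div_two.mpr hx0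
  have hsin : 1 / (n : ℝ) ≤ Real.sin (Real.arccos x) := by
    refine le_trans ?_ (Real.mul_le_sin (Real.arccos_nonneg x) harc)
    calc 1 / (n : ℝ) = 2 / Real.pi * (Real.pi / (2 * n)) := by field
      _ ≤ _ := by gcongr
  have hb := hbnd (Real.arccos x)
  rw [hcos, abs_mul, abs_of_nonneg (le_trans (by positivity) hsin)] at hb
  have := (mul_le_mul_of_nonneg_left hsin (abs_nonneg (Q.eval x))).trans hb
  rwa [mul_one_div, div_le_one (by positivity)] at this

open Polynomial Polynomial.Chebyshev in
/-- The odd part of `φ ↦ P (cos (θ + φ))` is `sin φ` times a polynomial in `cos φ`. -/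
lemma exists_eval_cos_add_sub_eval_cos_sub {n : ℕ} {P : ℝ[X]} (hP : P.degree ≤ n) (θ : ℝ) :
    ∃ R : ℝ[X], R.degree < n ∧ ∀ φ : ℝ,
      P.eval (Real.cos (θ + φ)) - P.eval (Real.cos (θ - φ))
        = 2 * (R.eval (Real.cos φ) * Real.sin φ) := by
  have hmem : P ∈ degreeLE ℝ n := mem_degreeLE.mpr hP
  clear hP
  rw [← Sequence.span_degreeLE (chebyshevTsequence ℝ) (by simp)] at hmem
  induction hmem using Submodule.span_induction with
  | mem p hp =>
    obtain ⟨k, hk, rfl⟩ := hp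
    rcases eq_or_ne k 0 with rfl | hk0
    · exact ⟨0, by simp, fun φ => by simp [chebyshevTsequence]⟩
    obtain ⟨m, rfl⟩ := Nat.exists_eq_succ_of_ne_zero hk0
    refine ⟨C (-Real.sin ((m + 1) * θ)) * U ℝ m, ?_, fun φ => ?_⟩
    · rw [← smul_eq_C_mul]
      refine (degree_smul_le _ _).trans_lt ?_
      rw [degree_U_natCast]
      exact_mod_cast (Set.mem_Iic.mp hk : m + 1 ≤ n)
    · have hU := U_real_cos φ m
      simp only [chebyshevTsequence, T_real_cos, eval_mul, eval_C]
      rw [mul_assoc, hU]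
      push_cast
      rw [mul_add, mul_sub, Real.cos_add, Real.cos_sub]
      ring
  | zero => exact ⟨0, by simp, fun φ => by simp⟩
  | add p q _ _ hp hq =>
    obtain ⟨R, hR, h⟩ := hp
    obtain ⟨S, hS, h'⟩ := hq
    refine ⟨R + S, (degree_add_le _ _).trans_lt (max_lt hR hS), fun φ => ?_⟩
    simp only [eval_add]
    linear_combination h φ + h' φ
  | smul a p _ hp =>
    obtain ⟨R, hR, h⟩ := hp
    refine ⟨a • R, (degree_smul_le _ _).trans_lt hR, fun φ => ?_⟩
    simp only [eval_smul, smul_eq_mul]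
    linear_combination a * h φ

open Polynomial in
/-- **Bernstein's inequality** in trigonometric form. -/
lemma abs_eval_derivative_cos_mul_sin_le {n : ℕ} (hn : n ≠ 0) {P : ℝ[X]} (hP : P.degree ≤ n)
    (hbnd : ∀ x ∈ Set.Icc (-1 : ℝ) 1, |P.eval x| ≤ 1) (θ : ℝ) :
    |P.derivative.eval (Real.cos θ) * Real.sin θ| ≤ n := by
  obtain ⟨R, hR, h⟩ := exists_eval_cos_add_sub_eval_cos_sub hP θ
  have hRn : |R.eval 1| ≤ n := by
    refine abs_eval_le_of_abs_eval_cos_mul_sin_le hn hR (fun φ => ?_) (by simp)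
    have h₁ := abs_le.mp (hbnd _ (Real.cos_mem_Icc (θ + φ)))
    have h₂ := abs_le.mp (hbnd _ (Real.cos_mem_Icc (θ - φ)))
    have := h φ
    exact abs_le.mpr ⟨by linarith, by linarith⟩
  have hl : HasDerivAt (fun φ => P.eval (Real.cos (θ + φ)) - P.eval (Real.cos (θ - φ)))
      (-2 * (P.derivative.eval (Real.cos θ) * Real.sin θ)) 0 := by
    have h₁ := (P.hasDerivAt (Real.cos (θ + 0))).comp (0 : ℝ)
      ((Real.hasDerivAt_cos (θ + 0)).comp (0 : ℝ) ((hasDerivAt_id (0 : ℝ)).const_add θ))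
    have h₂ := (P.hasDerivAt (Real.cos (θ - 0))).comp (0 : ℝ)
      ((Real.hasDerivAt_cos (θ - 0)).comp (0 : ℝ) ((hasDerivAt_id (0 : ℝ)).const_sub θ))
    convert! h₁.sub h₂ using 1
    simp only [add_zero, sub_zero]
    ring
  have hr : HasDerivAt (fun φ => 2 * (R.eval (Real.cos φ) * Real.sin φ)) (2 * R.eval 1) 0 := by
    have h₁ := (R.hasDerivAt (Real.cos 0)).comp (0 : ℝ) (Real.hasDerivAt_cos 0)
    convert! (h₁.mul (Real.hasDerivAt_sin 0)).const_mul 2 using 1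
    simp
  have heq := hl.unique (funext h ▸ hr)
  rw [show P.derivative.eval (Real.cos θ) * Real.sin θ = -R.eval 1 by linarith, abs_neg]
  exact hRn

open Polynomial in
/-- **Markov brothers' inequality** (first derivative) on `[-1, 1]`. -/
lemma abs_eval_derivative_le_sq {n : ℕ} {P : ℝ[X]} (hP : P.degree ≤ n)
    (hbnd : ∀ x ∈ Set.Icc (-1 : ℝ) 1, |P.eval x| ≤ 1) {x : ℝ} (hx : x ∈ Set.Icc (-1) 1) :
    |P.derivative.eval x| ≤ n ^ 2 := by
  rcases eq_or_ne n 0 with rfl | hn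
  · rw [eq_C_of_degree_le_zero (p := P) (by simpa using hP)]
    simp
  have hn' : (0 : ℝ) < n := by positivity
  have hdeg : (C (n : ℝ)⁻¹ * P.derivative).degree < n := by
    rw [← smul_eq_C_mul]
    refine (degree_smul_le _ _).trans_lt ?_
    rcases eq_or_ne P 0 with rfl | h0
    · simp
    · exact (degree_derivative_lt h0).trans_le hP
  have h := abs_eval_le_of_abs_eval_cos_mul_sin_le hn hdeg (fun θ => ?_) hx
  · rw [eval_mul, eval_C, abs_mul, abs_of_pos (inv_pos.mpr hn'), inv_mul_le_iff₀ hn'] at h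
    rwa [sq]
  · rw [eval_mul, eval_C, mul_assoc, abs_mul, abs_of_pos (inv_pos.mpr hn'), inv_mul_le_iff₀ hn',
      mul_one]
    exact abs_eval_derivative_cos_mul_sin_le hn hP hbnd θ

/-- Markov's "other" inequality: a real polynomial of degree `d` satisfies
`sup_{x ∈ [0,1]} |f'(x)| ≤ 2 d² · sup_{x ∈ [0,1]} |f(x)|`. -/
theorem markov_other_inequality (f : Polynomial ℝ) (d : ℕ) (hd : f.natDegree = d) :
    ∀ x ∈ Set.Icc (0:ℝ) 1,
      |f.derivative.eval x| ≤ 2 * (d:ℝ)^2 * ⨆ y : Set.Icc (0:ℝ) 1, |f.eval (y:ℝ)| := by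
  intro x hx
  set M := ⨆ y : Set.Icc (0:ℝ) 1, |f.eval (y:ℝ)| with hM
  have hle : ∀ y ∈ Set.Icc (0:ℝ) 1, |f.eval y| ≤ M := by
    intro y hy
    have hbdd : BddAbove (Set.range fun y : Set.Icc (0:ℝ) 1 => |f.eval (y:ℝ)|) :=
      (isCompact_range (by fun_prop)).bddAbove
    exact le_ciSup hbdd ⟨y, hy⟩
  rcases ((abs_nonneg _).trans (hle x hx)).eq_or_lt with h0 | hpos
  · have hf : f = 0 := by
      refine Polynomial.eq_zero_of_infinite_isRoot f
        ((Set.Icc_infinite (zero_lt_one (α := ℝ))).mono fun y hy => ?_)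
      have := hle y hy
      rw [← h0] at this
      exact abs_nonpos_iff.mp this
    simp [hf, ← h0]
  set L : Polynomial ℝ := Polynomial.C (1 / 2) * Polynomial.X + Polynomial.C (1 / 2) with hL
  set P : Polynomial ℝ := Polynomial.C M⁻¹ * f.comp L with hPdef
  have hLdeg : L.natDegree ≤ 1 := Polynomial.natDegree_linear_le
  have hP : P.degree ≤ d := by
    refine Polynomial.degree_le_of_natDegree_le ?_
    refine (Polynomial.natDegree_C_mul_le _ _).trans (Polynomial.natDegree_comp_le.trans ?_)
    rw [hd]
    exact (Nat.mul_le_mul_left d hLdeg).trans_eq (mul_one d)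
  have hbnd : ∀ t ∈ Set.Icc (-1 : ℝ) 1, |P.eval t| ≤ 1 := by
    intro t ht
    simp only [hPdef, hL, Polynomial.eval_mul, Polynomial.eval_C, Polynomial.eval_comp,
      Polynomial.eval_add, Polynomial.eval_X]
    rw [abs_mul, abs_of_pos (inv_pos.mpr hpos), inv_mul_le_iff₀ hpos, mul_one]
    exact hle _ ⟨by linarith [ht.1], by linarith [ht.2]⟩
  have h := abs_eval_derivative_le_sq hP hbnd
    (show 2 * x - 1 ∈ Set.Icc (-1 : ℝ) 1 from ⟨by linarith [hx.1], by linarith [hx.2]⟩)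
  have hev : P.derivative.eval (2 * x - 1) = M⁻¹ * (1 / 2 * f.derivative.eval x) := by
    have : (1 / 2 : ℝ) * (2 * x - 1) + 1 / 2 = x := by ring
    simp only [hPdef, hL, Polynomial.derivative_mul, Polynomial.derivative_comp,
      Polynomial.derivative_add, Polynomial.derivative_C, Polynomial.derivative_X,
      Polynomial.eval_mul, Polynomial.eval_add, Polynomial.eval_C, Polynomial.eval_X,
      Polynomial.eval_comp, Polynomial.eval_zero, Polynomial.eval_one, this]
    ring
  rw [hev, abs_mul, abs_of_pos (inv_pos.mpr hpos), inv_mul_le_iff₀ hpos, abs_mul,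
    abs_of_pos (by norm_num : (0 : ℝ) < 1 / 2)] at h
  linarith
end

section
/- Let f be a real polynomial of degree d, and let N0 be a nonnegative integer with d^2 ≤ (N0+1)/4. Then sup_{N ≥ N0, N integer} N·|f(1/N) − f(0)| ≤ sup_{x ∈ [0, 1/N0]} |f'(x)| ≤ 4 d^2 N0 · sup_{N ≥ N0, N integer} |f(1/N)|. -/
open Polynomial in
/-- Markov's inequality at the right endpoint of an interval. -/
theorem abs_eval_derivative_right_le {P : ℝ[X]} {n : ℕ} {a b A : ℝ} (hab : a < b) (hA : 0 ≤ A)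
    (hn : P.natDegree ≤ n) (hP : ∀ x ∈ Set.Icc a b, |P.eval x| ≤ A) :
    (b - a) * |P.derivative.eval b| ≤ 2 * (n : ℝ) ^ 2 * A := by
  have key : ∀ A' : ℝ, 0 < A' → (∀ x ∈ Set.Icc a b, |P.eval x| ≤ A') → ∀ s : ℝ, |s| = 1 →
      (b - a) * (s * P.derivative.eval b) ≤ 2 * (n : ℝ) ^ 2 * A' := by
    intro A' hA' hP' s hs
    set Q : ℝ[X] := C (s / A') * P.comp (C ((b - a) / 2) * X + C ((a + b) / 2)) with hQ
    have hdeg : Q.degree ≤ n := by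
      refine degree_le_of_natDegree_le ?_
      calc Q.natDegree ≤ (P.comp (C ((b - a) / 2) * X + C ((a + b) / 2))).natDegree :=
            natDegree_C_mul_le _ _
        _ ≤ P.natDegree * (C ((b - a) / 2) * X + C ((a + b) / 2)).natDegree := natDegree_comp_le
        _ ≤ P.natDegree * 1 := Nat.mul_le_mul_left _ natDegree_linear_le
        _ ≤ n := by simpa using hn
    have hbd : ∀ x ∈ Set.Icc (-1 : ℝ) 1, |Q.eval x| ≤ 1 := by
      intro x hx
      have h1 := hP' ((b - a) / 2 * x + (a + b) / 2)
        ⟨by nlinarith [hx.1, hx.2], by nlinarith [hx.1, hx.2]⟩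
      simp only [hQ, eval_mul, eval_C, eval_comp, eval_add, eval_X, abs_mul, abs_div, hs,
        abs_of_pos hA']
      rw [div_mul_eq_mul_div, one_mul]
      exact (div_le_one hA').2 h1
    have h2 := Chebyshev.eval_iterate_derivative_le_of_forall_abs_le_one (k := 1) le_rfl hdeg hbd
    simp only [Function.iterate_one, Chebyshev.derivative_T_eval_one] at h2
    have h3 : Q.derivative.eval 1 = (b - a) * (s * P.derivative.eval b) / (2 * A') := by
      have : (b - a) / 2 + (a + b) / 2 = b := by ring
      simp only [hQ, derivative_C_mul, derivative_comp, eval_mul, eval_C, eval_comp, eval_add,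
        eval_X, derivative_add, derivative_X, derivative_C, mul_one, add_zero, this]
      field_simp
    rw [h3, div_le_iff₀ (by positivity)] at h2
    push_cast at h2
    linarith
  refine le_of_forall_pos_le_add fun ε hε => ?_
  have hpos : (0 : ℝ) < 2 * (n : ℝ) ^ 2 + 1 := by positivity
  have hA' : 0 < A + ε / (2 * (n : ℝ) ^ 2 + 1) := by positivity
  have hP' : ∀ x ∈ Set.Icc a b, |P.eval x| ≤ A + ε / (2 * (n : ℝ) ^ 2 + 1) := fun x hx =>
    (hP x hx).trans (le_add_of_nonneg_right (by positivity))
  have hε' : 2 * (n : ℝ) ^ 2 * (ε / (2 * (n : ℝ) ^ 2 + 1)) ≤ ε := by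
    rw [mul_div_assoc', div_le_iff₀ hpos]
    nlinarith
  have h1 := key _ hA' hP' 1 (by simp)
  have h2 := key _ hA' hP' (-1) (by simp)
  rcases abs_cases (P.derivative.eval b) with ⟨h, -⟩ | ⟨h, -⟩ <;> rw [h] <;> linarith

open Polynomial in
/-- A Markov inequality on the right half of `[0, L]`, from the endpoint inequality for
`P(y²)`. -/
theorem abs_eval_derivative_le_of_half_le {P : ℝ[X]} {n : ℕ} {L A x : ℝ} (hL : 0 < L)
    (hA : 0 ≤ A) (hn : P.natDegree ≤ n) (hP : ∀ x ∈ Set.Icc 0 L, |P.eval x| ≤ A)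
    (hx : L / 2 ≤ x) (hxL : x ≤ L) :
    L * |P.derivative.eval x| ≤ 7 / 2 * (n : ℝ) ^ 2 * A := by
  have hx0 : 0 < x := by linarith
  have hsx : 0 < √x := Real.sqrt_pos.2 hx0
  have hsL : 0 < √L := Real.sqrt_pos.2 hL
  have hsx2 : √x ^ 2 = x := Real.sq_sqrt hx0.le
  have hsL2 : √L ^ 2 = L := Real.sq_sqrt hL.le
  have hle : √x ≤ √L := Real.sqrt_le_sqrt hxL
  have hdeg : (P.comp (X ^ 2)).natDegree ≤ 2 * n := by
    rw [natDegree_comp, natDegree_X_pow]; omega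
  have h1 := abs_eval_derivative_right_le (a := -√L) (b := √x) (A := A) (P := P.comp (X ^ 2))
    (by linarith) hA hdeg (by
      intro y hy
      rw [eval_comp, eval_pow, eval_X]
      refine hP _ ⟨sq_nonneg y, ?_⟩
      rw [← hsL2]
      exact sq_le_sq' hy.1 (hy.2.trans hle))
  have h2 : (P.comp (X ^ 2)).derivative.eval √x = 2 * √x * P.derivative.eval x := by
    simp [derivative_comp, hsx2, one_add_one_eq_two]
  rw [h2, abs_mul, abs_of_pos (by positivity : 0 < 2 * √x)] at h1
  push_cast at h1
  have h3 : 9 / 14 * L ≤ √L * √x := by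
    rw [← Real.sqrt_mul hL.le]
    apply Real.le_sqrt_of_sq_le
    nlinarith
  have h4 : 8 / 7 * L ≤ (√x - -√L) * √x := by nlinarith
  have h5 := mul_le_mul_of_nonneg_right h4 (abs_nonneg (P.derivative.eval x))
  nlinarith

open Polynomial in
/-- A form of Markov's inequality on `[0, L]`, with constant `7 / 2` in place of the
optimal `2`. -/
theorem abs_eval_derivative_le {P : ℝ[X]} {n : ℕ} {L A x : ℝ} (hL : 0 < L)
    (hA : 0 ≤ A) (hn : P.natDegree ≤ n) (hP : ∀ x ∈ Set.Icc 0 L, |P.eval x| ≤ A)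
    (hx : x ∈ Set.Icc 0 L) :
    L * |P.derivative.eval x| ≤ 7 / 2 * (n : ℝ) ^ 2 * A := by
  rcases le_total (L / 2) x with h | h
  · exact abs_eval_derivative_le_of_half_le hL hA hn hP h hx.2
  · have hdeg : (P.comp (C L - X)).natDegree ≤ n := by
      rw [natDegree_comp, ← neg_sub, natDegree_neg, natDegree_X_sub_C, mul_one]
      exact hn
    have h1 := abs_eval_derivative_le_of_half_le (P := P.comp (C L - X)) (x := L - x) hL hA hdeg
      (by
        intro y hy
        simp only [eval_comp, eval_sub, eval_C, eval_X]
        exact hP _ ⟨by linarith [hy.2], by linarith [hy.1]⟩) (by linarith) (by linarith [hx.1])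
    simpa [derivative_comp] using h1

open Polynomial in
/-- A second-order Taylor estimate at a critical point of a polynomial. -/
theorem abs_eval_sub_eval_le_of_derivative_eq_zero {P : ℝ[X]} {a b ξ p D : ℝ}
    (hξ : ξ ∈ Set.Icc a b) (hp : p ∈ Set.Icc a b) (h0 : P.derivative.eval ξ = 0)
    (hD : ∀ x ∈ Set.Icc a b, |P.derivative.derivative.eval x| ≤ D) :
    |P.eval p - P.eval ξ| ≤ D / 2 * (p - ξ) ^ 2 := by
  have hder : ∀ z ∈ Set.Icc a b, |P.derivative.eval z| ≤ D * |z - ξ| := by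
    intro z hz
    have := (convex_Icc a b).norm_image_sub_le_of_norm_hasDerivWithin_le
      (f := fun x => P.derivative.eval x) (f' := fun x => P.derivative.derivative.eval x)
      (fun x _ => (P.derivative.hasDerivAt x).hasDerivWithinAt) hD hξ hz
    simpa [h0] using this
  have hq : ∀ x, HasDerivAt (fun t : ℝ => (t - ξ) ^ 2) (2 * (x - ξ)) x := fun x => by
    simpa using ((hasDerivAt_id x).sub_const ξ).fun_pow 2
  have main : ∀ c ∈ Set.Icc a b, c ≠ ξ →
      (p - ξ) ^ 2 * P.derivative.eval c = (P.eval p - P.eval ξ) * (2 * (c - ξ)) →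
      |P.eval p - P.eval ξ| ≤ D / 2 * (p - ξ) ^ 2 := by
    intro c hc hcξ h
    have hpos : 0 < |c - ξ| := abs_pos.2 (sub_ne_zero.2 hcξ)
    have h1 := congrArg abs h
    rw [abs_mul, abs_mul, abs_mul, abs_two, abs_of_nonneg (sq_nonneg (p - ξ))] at h1
    have h2 := mul_le_mul_of_nonneg_left (hder c hc) (sq_nonneg (p - ξ))
    rw [h1] at h2
    refine le_of_mul_le_mul_right ?_ hpos
    linarith
  rcases lt_trichotomy ξ p with h | rfl | h
  · obtain ⟨c, hc, hc'⟩ := exists_ratio_hasDerivAt_eq_ratio_slope (fun x => P.eval x)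
      (fun x => P.derivative.eval x) h P.continuous.continuousOn (fun x _ => P.hasDerivAt x)
      (fun t => (t - ξ) ^ 2) (fun x => 2 * (x - ξ)) (by fun_prop) (fun x _ => hq x)
    refine main c ⟨hξ.1.trans hc.1.le, hc.2.le.trans hp.2⟩ hc.1.ne' ?_
    simp only [sub_self] at hc'
    linarith
  · simp
  · obtain ⟨c, hc, hc'⟩ := exists_ratio_hasDerivAt_eq_ratio_slope (fun x => P.eval x)
      (fun x => P.derivative.eval x) h P.continuous.continuousOn (fun x _ => P.hasDerivAt x)
      (fun t => (t - ξ) ^ 2) (fun x => 2 * (x - ξ)) (by fun_prop) (fun x _ => hq x)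
    refine main c ⟨hp.1.trans hc.1.le, hc.2.le.trans hξ.2⟩ hc.2.ne ?_
    simp only [sub_self] at hc'
    linarith

theorem exists_nat_abs_one_div_sub_le {N₀ : ℕ} (hN : 0 < N₀) {ξ : ℝ} (h0 : 0 < ξ)
    (h1 : ξ ≤ 1 / (N₀ : ℝ)) :
    ∃ N : ℕ, N₀ ≤ N ∧ |1 / (N : ℝ) - ξ| ≤ 1 / (2 * N₀ * (N₀ + 1)) := by
  have hN' : (0 : ℝ) < N₀ := Nat.cast_pos.2 hN
  set N := ⌊1 / ξ⌋₊ with hNdef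
  have hle : N₀ ≤ N := Nat.le_floor ((le_one_div hN' h0).2 h1)
  have hle' : (N₀ : ℝ) ≤ N := Nat.cast_le.2 hle
  have hNpos : (0 : ℝ) < N := hN'.trans_le hle'
  have h2 : ξ ≤ 1 / (N : ℝ) :=
    (le_one_div h0 hNpos).2 (Nat.floor_le (by positivity))
  have h3 : 1 / ((N : ℝ) + 1) ≤ ξ :=
    (one_div_le h0 (by positivity)).1 (Nat.lt_floor_add_one (1 / ξ)).le
  have h4 : 1 / (N : ℝ) - 1 / ((N : ℝ) + 1) = 2 * (1 / (2 * N * (N + 1))) := by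
    field_simp; ring
  have h5 : 1 / (2 * (N : ℝ) * (N + 1)) ≤ 1 / (2 * N₀ * (N₀ + 1)) := by gcongr
  rcases le_total (1 / (N : ℝ) - ξ) (1 / (2 * (N : ℝ) * (N + 1))) with h | h
  · exact ⟨N, hle, abs_le.2 ⟨by linarith [show (0 : ℝ) ≤ 1 / (2 * N₀ * (N₀ + 1)) by positivity],
      h.trans h5⟩⟩
  · refine ⟨N + 1, by omega, ?_⟩
    push_cast
    exact abs_le.2 ⟨by linarith, by
      linarith [show (0 : ℝ) ≤ 1 / (2 * N₀ * (N₀ + 1)) by positivity]⟩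

open Polynomial in
/-- A polynomial of low degree is controlled on `[0, 1 / N₀]` by its values at the points
`1 / N`. -/
theorem abs_eval_le_of_forall_one_div {f : ℝ[X]} {d N₀ : ℕ} {M : ℝ} (hd : f.natDegree ≤ d)
    (hN : 0 < N₀) (h : (d : ℝ) ^ 2 ≤ ((N₀ : ℝ) + 1) / 4)
    (hM : ∀ N : ℕ, N₀ ≤ N → |f.eval (1 / (N : ℝ))| ≤ M) :
    ∀ x ∈ Set.Icc 0 (1 / (N₀ : ℝ)), |f.eval x| ≤ 512 / 463 * M := by
  have hN' : (0 : ℝ) < N₀ := Nat.cast_pos.2 hN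
  have hL : (0 : ℝ) < 1 / (N₀ : ℝ) := by positivity
  have hM0 : 0 ≤ M := (abs_nonneg _).trans (hM N₀ le_rfl)
  obtain ⟨ξ, hξ, hmax⟩ := isCompact_Icc.exists_isMaxOn (Set.nonempty_Icc.2 hL.le)
    (f.continuous.abs.continuousOn)
  have hB : ∀ x ∈ Set.Icc 0 (1 / (N₀ : ℝ)), |f.eval x| ≤ |f.eval ξ| := fun x hx => hmax hx
  suffices |f.eval ξ| ≤ 512 / 463 * M from fun x hx => (hB x hx).trans this
  rcases hξ.1.eq_or_lt with h0 | h0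
  · have : |f.eval ξ| ≤ M := by
      rw [← h0]
      refine le_of_tendsto ((f.continuous.abs.tendsto 0).comp
        (tendsto_one_div_atTop_nhds_zero_nat (𝕜 := ℝ))) ?_
      filter_upwards [Filter.eventually_ge_atTop N₀] with N hN using hM N hN
    linarith
  rcases hξ.2.eq_or_lt with h1 | h1
  · have := hM N₀ le_rfl
    rw [← h1] at this
    linarith
  have hcrit : f.derivative.eval ξ = 0 := by
    have hnhds : Set.Icc 0 (1 / (N₀ : ℝ)) ∈ nhds ξ := Icc_mem_nhds h0 h1
    have hext : IsLocalExtr (fun x => f.eval x) ξ := by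
      rcases abs_cases (f.eval ξ) with ⟨h2, -⟩ | ⟨h2, -⟩
      · right
        filter_upwards [hnhds] with x hx
        have := hB x hx
        rw [h2] at this
        exact (le_abs_self _).trans this
      · left
        filter_upwards [hnhds] with x hx
        have := hB x hx
        rw [h2] at this
        linarith [neg_abs_le (f.eval x)]
    exact hext.hasDerivAt_eq_zero (f.hasDerivAt ξ)
  set B := |f.eval ξ| with hBdef
  have hB0 : 0 ≤ B := abs_nonneg _
  set K : ℝ := 7 / 2 * (d : ℝ) ^ 2 * N₀ with hK
  have hK0 : 0 ≤ K := by positivity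
  have hscale : ∀ y A : ℝ, 1 / (N₀ : ℝ) * y ≤ 7 / 2 * (d : ℝ) ^ 2 * A → y ≤ K * A := by
    intro y A hy
    rw [div_mul_eq_mul_div, one_mul, div_le_iff₀ hN'] at hy
    rw [hK]; linarith
  have hD1 : ∀ x ∈ Set.Icc 0 (1 / (N₀ : ℝ)), |f.derivative.eval x| ≤ K * B := fun x hx =>
    hscale _ _ (abs_eval_derivative_le hL hB0 hd hB hx)
  have hD2 : ∀ x ∈ Set.Icc 0 (1 / (N₀ : ℝ)), |f.derivative.derivative.eval x| ≤ K * (K * B) :=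
    fun x hx => hscale _ _ (abs_eval_derivative_le hL (by positivity)
      ((natDegree_derivative_le f).trans (by omega)) hD1 hx)
  obtain ⟨N, hNN, hdist⟩ := exists_nat_abs_one_div_sub_le hN h0 hξ.2
  have hNmem : 1 / (N : ℝ) ∈ Set.Icc 0 (1 / (N₀ : ℝ)) := ⟨by positivity, by gcongr⟩
  have hT := abs_eval_sub_eval_le_of_derivative_eq_zero hξ hNmem hcrit hD2
  have hKd : K * |1 / (N : ℝ) - ξ| ≤ 7 / 16 := by
    calc K * |1 / (N : ℝ) - ξ| ≤ K * (1 / (2 * N₀ * (N₀ + 1))) := by gcongr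
      _ = 7 / 4 * ((d : ℝ) ^ 2 / (N₀ + 1)) := by rw [hK]; field_simp; ring
      _ ≤ 7 / 4 * (1 / 4) := by
        refine mul_le_mul_of_nonneg_left ?_ (by norm_num)
        rw [div_le_iff₀ (by positivity)]
        linarith
      _ = 7 / 16 := by norm_num
  have hsq : (K * |1 / (N : ℝ) - ξ|) ^ 2 ≤ (7 / 16) ^ 2 := by gcongr
  rw [mul_pow, sq_abs] at hsq
  have hfin : K * (K * B) / 2 * (1 / (N : ℝ) - ξ) ^ 2 ≤ 49 / 512 * B := by
    have := mul_le_mul_of_nonneg_right hsq hB0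
    nlinarith
  have htri : B ≤ |f.eval (1 / (N : ℝ))| + |f.eval (1 / (N : ℝ)) - f.eval ξ| := by
    rw [hBdef, abs_sub_comm]
    linarith [abs_sub_abs_le_abs_sub (f.eval ξ) (f.eval (1 / (N : ℝ)))]
  linarith [hM N hNN]

/-- Large-`N` interpolation: for a real polynomial `f` of degree `d` and a nonnegative
integer `N₀` with `d² ≤ (N₀+1)/4`,
`sup_{N ≥ N₀} N·|f(1/N) − f(0)| ≤ sup_{x ∈ [0,1/N₀]} |f'(x)| ≤ 4 d² N₀ · sup_{N ≥ N₀} |f(1/N)|`. -/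
theorem large_N_interpolation (f : Polynomial ℝ) (d N₀ : ℕ) (hd : f.natDegree = d)
    (h : (d:ℝ)^2 ≤ ((N₀:ℝ) + 1) / 4) :
    (⨆ N : {N : ℕ // N₀ ≤ N}, (N:ℝ) * |f.eval (1 / (N:ℝ)) - f.eval 0|)
        ≤ (⨆ x : Set.Icc (0:ℝ) (1 / (N₀:ℝ)), |f.derivative.eval (x:ℝ)|) ∧
    (⨆ x : Set.Icc (0:ℝ) (1 / (N₀:ℝ)), |f.derivative.eval (x:ℝ)|)
        ≤ 4 * (d:ℝ)^2 * (N₀:ℝ) * ⨆ N : {N : ℕ // N₀ ≤ N}, |f.eval (1 / (N:ℝ))| := by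
  rcases Nat.eq_zero_or_pos N₀ with rfl | hN
  · have hd0 : d = 0 := by
      by_contra hne
      have : (1 : ℝ) ≤ d := Nat.one_le_cast.2 (Nat.one_le_iff_ne_zero.2 hne)
      norm_num at h
      nlinarith
    obtain ⟨c, rfl⟩ := Polynomial.natDegree_eq_zero.1 (hd.trans hd0)
    simp
  have hN' : (0 : ℝ) < N₀ := Nat.cast_pos.2 hN
  have hL : (0 : ℝ) < 1 / (N₀ : ℝ) := by positivity
  have hmem : ∀ N : ℕ, N₀ ≤ N → 1 / (N : ℝ) ∈ Set.Icc 0 (1 / (N₀ : ℝ)) := fun N hNN =>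
    ⟨by positivity, by gcongr⟩
  have : Nonempty {N : ℕ // N₀ ≤ N} := ⟨⟨N₀, le_rfl⟩⟩
  have : Nonempty (Set.Icc (0 : ℝ) (1 / (N₀ : ℝ))) := ⟨⟨0, le_rfl, hL.le⟩⟩
  have hbdd : ∀ P : Polynomial ℝ, ∃ A, ∀ x ∈ Set.Icc 0 (1 / (N₀ : ℝ)), |P.eval x| ≤ A := fun P =>
    isCompact_Icc.exists_bound_of_continuousOn P.continuous.continuousOn
  constructor
  · obtain ⟨A, hA⟩ := hbdd f.derivative
    refine ciSup_le fun ⟨N, hNN⟩ => ?_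
    have hNpos : (0 : ℝ) < N := Nat.cast_pos.2 (hN.trans_le hNN)
    obtain ⟨c, hc, hc'⟩ := exists_hasDerivAt_eq_slope (fun x => f.eval x)
      (fun x => f.derivative.eval x) (one_div_pos.2 hNpos) f.continuous.continuousOn
      (fun x _ => f.hasDerivAt x)
    have hval : (N : ℝ) * |f.eval (1 / (N : ℝ)) - f.eval 0| = |f.derivative.eval c| := by
      simp only [sub_zero] at hc'
      rw [hc', abs_div, abs_of_pos (one_div_pos.2 hNpos)]
      field_simp
    simp only [hval]
    exact le_ciSup (f := fun x : Set.Icc (0 : ℝ) (1 / (N₀ : ℝ)) => |f.derivative.eval (x : ℝ)|)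
      ⟨A, by rintro _ ⟨x, rfl⟩; exact hA x x.2⟩ ⟨c, hc.1.le, hc.2.le.trans (hmem N hNN).2⟩
  · obtain ⟨A, hA⟩ := hbdd f
    set M := ⨆ N : {N : ℕ // N₀ ≤ N}, |f.eval (1 / (N : ℝ))| with hMdef
    have hM : ∀ N : ℕ, N₀ ≤ N → |f.eval (1 / (N : ℝ))| ≤ M := fun N hNN =>
      le_ciSup (f := fun N : {N : ℕ // N₀ ≤ N} => |f.eval (1 / (N : ℝ))|)
        ⟨A, by rintro _ ⟨N, rfl⟩; exact hA _ (hmem N N.2)⟩ ⟨N, hNN⟩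
    have hM0 : 0 ≤ M := (abs_nonneg _).trans (hM N₀ le_rfl)
    refine ciSup_le fun ⟨x, hx⟩ => ?_
    have h1 := abs_eval_derivative_le hL (by positivity) hd.le
      (abs_eval_le_of_forall_one_div hd.le hN h hM) hx
    rw [div_mul_eq_mul_div, one_mul, div_le_iff₀ hN'] at h1
    have h2 : 0 ≤ (d : ℝ) ^ 2 * N₀ * M := by positivity
    simp only
    linarith
end
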